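/- Let p > 1, q > 1 and T > 0. For every R > 0 and every n ∈ ℕ (n ≥ 1), the pair λ_n(R) = (q/p*)·(nπ_{pq}/T)^p·R^{p−q} and u_{n,R}(t) = R·sin_{pq}(nπ_{pq}t/T) is an eigenpair: u_{n,R} and −u_{n,R} are nontrivial classical solutions of (φ_p(u'))' + λ_n(R)·φ_q(u) = 0 on (0,T) with u(0) = u(T) = 0. Conversely, if (λ, u) with λ > 0 and u a nontrivial classical solution of this boundary value problem, then there exist n ∈ ℕ (n ≥ 1) and R > 0 such that λ = λ_n(R) and u = u_{n,R} or u = −u_{n,R}. -/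

import Mathlib

open Real Set Filter MeasureTheory

/-- Generalized arcsine: `arcsin_{pq}(σ) = ∫_0^σ (1 - s^q)^(-1/p) ds`. -/
noncomputable def arcsinPQ (p q σ : ℝ) : ℝ :=
  ∫ s in (0:ℝ)..σ, (1 - s ^ q) ^ (-(1 / p))

/-- The generalized half-period `π_{pq} = 2 arcsin_{pq}(1)`. -/
noncomputable def piPQ (p q : ℝ) : ℝ := 2 * arcsinPQ p q 1

/-- Generalized incomplete elliptic integral:
`arcsn_{pq}(σ,k) = ∫_0^σ ((1-s^q)(1-k^q s^q))^(-1/p) ds`. -/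
noncomputable def arcsnPQ (p q k σ : ℝ) : ℝ :=
  ∫ s in (0:ℝ)..σ, ((1 - s ^ q) * (1 - k ^ q * s ^ q)) ^ (-(1 / p))

/-- Generalized complete elliptic integral `K_{pq}(k) = arcsn_{pq}(1,k)`. -/
noncomputable def Kpq (p q k : ℝ) : ℝ := arcsnPQ p q k 1

/-- `φ_m(s) = |s|^(m-2) s` for `s ≠ 0`, `φ_m(0) = 0`. -/
noncomputable def phi (m s : ℝ) : ℝ := if s = 0 then 0 else |s| ^ (m - 2) * s

/-- Incomplete beta function `B̃(a,b,u) = ∫_0^u z^(a-1) (1-z)^(b-1) dz`. -/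
noncomputable def incBeta (a b u : ℝ) : ℝ :=
  ∫ z in (0:ℝ)..u, z ^ (a - 1) * (1 - z) ^ (b - 1)

/-- A classical solution of `(φ_p(u'))' + λ φ_q(u) = 0` on `(0,T)` with
`u(0) = u(T) = 0`: `u ∈ C¹([0,T])`, `t ↦ φ_p(u'(t))` is differentiable on `(0,T)`
and the equation holds at every point of `(0,T)`. -/
def IsSolE (p q T lam : ℝ) (u : ℝ → ℝ) : Prop :=
  ∃ u' : ℝ → ℝ,
    (∀ t ∈ Set.Icc 0 T, HasDerivWithinAt u (u' t) (Set.Icc 0 T) t) ∧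
    ContinuousOn u' (Set.Icc 0 T) ∧
    (∀ t ∈ Set.Ioo 0 T, HasDerivWithinAt (fun s => phi p (u' s))
      (-(lam * phi q (u t))) (Set.Ioo 0 T) t) ∧
    u 0 = 0 ∧ u T = 0

/-- A classical solution of `(φ_p(u'))' + λ φ_q(u)(1 - |u|^q) = 0` on `(0,T)` with
`u(0) = u(T) = 0`. -/
def IsSolP (p q T lam : ℝ) (u : ℝ → ℝ) : Prop :=
  ∃ u' : ℝ → ℝ,
    (∀ t ∈ Set.Icc 0 T, HasDerivWithinAt u (u' t) (Set.Icc 0 T) t) ∧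
    ContinuousOn u' (Set.Icc 0 T) ∧
    (∀ t ∈ Set.Ioo 0 T, HasDerivWithinAt (fun s => phi p (u' s))
      (-(lam * phi q (u t) * (1 - |u t| ^ q))) (Set.Ioo 0 T) t) ∧
    u 0 = 0 ∧ u T = 0

/-- `Φ(k) = (1+k^q)^(1/p) (2k^q/(1+k^q))^(1/q - 1/p) K_{pq}(k)`. -/
noncomputable def PhiFun (p q k : ℝ) : ℝ :=
  (1 + k ^ q) ^ (1 / p) * (2 * k ^ q / (1 + k ^ q)) ^ (1 / q - 1 / p) * Kpq p q k

open scoped Topology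

theorem phi_eq (m s : ℝ) : phi m s = |s| ^ (m - 2) * s := by
  unfold phi; split_ifs with h <;> simp [h]

theorem phi_eq_sign (m s : ℝ) : phi m s = Real.sign s * |s| ^ (m - 1) := by
  rcases lt_trichotomy s 0 with h | rfl | h
  · rw [phi_eq, Real.sign_of_neg h, show m - 1 = m - 2 + 1 by ring,
      Real.rpow_add_one (abs_pos.2 h.ne).ne', abs_of_neg h]
    ring
  · simp [phi]
  · rw [phi_eq, Real.sign_of_pos h, show m - 1 = m - 2 + 1 by ring,
      Real.rpow_add_one (abs_pos.2 h.ne').ne', abs_of_pos h]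
    ring

theorem phi_of_nonneg {m s : ℝ} (hm : 1 < m) (hs : 0 ≤ s) : phi m s = s ^ (m - 1) := by
  rcases hs.eq_or_lt with rfl | hs
  · simp [phi, Real.zero_rpow (sub_pos.2 hm).ne']
  · rw [phi_eq_sign, Real.sign_of_pos hs, abs_of_pos hs, one_mul]

theorem phi_zero (m : ℝ) : phi m 0 = 0 := by simp [phi]

theorem phi_neg (m s : ℝ) : phi m (-s) = -phi m s := by
  rw [phi_eq, phi_eq, abs_neg, mul_neg]

theorem phi_mul_of_pos (m : ℝ) {a : ℝ} (ha : 0 < a) (s : ℝ) :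
    phi m (a * s) = a ^ (m - 1) * phi m s := by
  rw [phi_eq_sign, phi_eq_sign, abs_mul, abs_of_pos ha, Real.mul_rpow ha.le (abs_nonneg s)]
  have : Real.sign (a * s) = Real.sign s := by
    rcases lt_trichotomy s 0 with h | rfl | h
    · rw [Real.sign_of_neg h, Real.sign_of_neg (mul_neg_of_pos_of_neg ha h)]
    · simp
    · rw [Real.sign_of_pos h, Real.sign_of_pos (mul_pos ha h)]
  rw [this]; ring

theorem abs_phi {m : ℝ} (hm : 1 < m) (s : ℝ) : |phi m s| = |s| ^ (m - 1) := by
  rcases le_total 0 s with h | h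
  · rw [phi_of_nonneg hm h, abs_of_nonneg h, abs_of_nonneg (Real.rpow_nonneg h _)]
  · rw [← abs_neg, ← phi_neg, phi_of_nonneg hm (neg_nonneg.2 h), abs_of_nonpos h,
      abs_of_nonneg (Real.rpow_nonneg (neg_nonneg.2 h) _)]

theorem sign_phi (m s : ℝ) : Real.sign (phi m s) = Real.sign s := by
  rw [phi_eq]
  rcases lt_trichotomy s 0 with h | rfl | h
  · rw [Real.sign_of_neg h, Real.sign_of_neg]
    exact mul_neg_of_pos_of_neg (Real.rpow_pos_of_pos (abs_pos.2 h.ne) _) h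
  · simp
  · rw [Real.sign_of_pos h, Real.sign_of_pos]
    positivity

theorem sign_mul_abs_self (s : ℝ) : Real.sign s * |s| = s := by
  rcases lt_trichotomy s 0 with h | rfl | h
  · rw [Real.sign_of_neg h, abs_of_neg h]; ring
  · simp
  · rw [Real.sign_of_pos h, abs_of_pos h]; ring

theorem one_lt_div_sub_one {p : ℝ} (hp : 1 < p) : 1 < p / (p - 1) := by
  rw [one_lt_div (sub_pos.2 hp)]; linarith

theorem phi_conj_phi {p : ℝ} (hp : 1 < p) (s : ℝ) : phi (p / (p - 1)) (phi p s) = s := by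
  have hp1 : p - 1 ≠ 0 := (sub_pos.2 hp).ne'
  rw [phi_eq_sign, sign_phi, abs_phi hp, ← Real.rpow_mul (abs_nonneg s),
    show (p - 1) * (p / (p - 1) - 1) = 1 by field_simp; ring, Real.rpow_one,
    sign_mul_abs_self]

theorem abs_phi_rpow_conj {p : ℝ} (hp : 1 < p) (s : ℝ) :
    |phi p s| ^ (p / (p - 1)) = |s| ^ p := by
  have hp1 : p - 1 ≠ 0 := (sub_pos.2 hp).ne'
  rw [abs_phi hp, ← Real.rpow_mul (abs_nonneg s), mul_div_cancel₀ _ hp1]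

theorem hasDerivAt_abs_rpow_phi {m : ℝ} (hm : 1 < m) (s : ℝ) :
    HasDerivAt (fun x : ℝ => |x| ^ m) (m * phi m s) s := by
  rw [phi_eq, ← mul_assoc]
  exact hasDerivAt_abs_rpow s hm

theorem contDiff_abs_rpow {m : ℝ} (hm : 1 < m) : ContDiff ℝ 1 (fun x : ℝ => |x| ^ m) :=
  contDiff_norm_rpow hm

theorem continuous_phi {m : ℝ} (hm : 1 < m) : Continuous (phi m) := by
  have h := (contDiff_abs_rpow hm).continuous_deriv le_rfl
  have h2 : phi m = fun s => m⁻¹ * deriv (fun x : ℝ => |x| ^ m) s := by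
    funext s
    rw [(hasDerivAt_abs_rpow_phi hm s).deriv, inv_mul_cancel_left₀ (by linarith)]
  rw [h2]
  exact continuous_const.mul h

theorem eventually_sign_eq {f : ℝ → ℝ} {s : Set ℝ} {a : ℝ} (hf : ContinuousWithinAt f s a)
    (ha : f a ≠ 0) : ∀ᶠ t in 𝓝[s] a, Real.sign (f t) = Real.sign (f a) := by
  rcases ha.lt_or_gt with h | h
  · filter_upwards [hf.eventually_lt_const h] with t ht
    rw [Real.sign_of_neg h, Real.sign_of_neg ht]
  · filter_upwards [hf.eventually_const_lt h] with t ht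
    rw [Real.sign_of_pos h, Real.sign_of_pos ht]

theorem eventually_eq_of_autonomous {f g v : ℝ → ℝ} {a : ℝ} (hv : ContDiffAt ℝ 1 v (f a))
    (hfg : f a = g a)
    (hf : ∀ᶠ t in 𝓝[≥] a, HasDerivWithinAt f (v (f t)) (Ici t) t ∧ ContinuousWithinAt f (Ici a) t)
    (hg : ∀ᶠ t in 𝓝[≥] a, HasDerivWithinAt g (v (g t)) (Ici t) t ∧ ContinuousWithinAt g (Ici a) t) :
    ∀ᶠ t in 𝓝[≥] a, f t = g t := by
  obtain ⟨K, s, hs, hK⟩ := hv.exists_lipschitzOnWith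
  have hfa := (hf.self_of_nhdsWithin self_mem_Ici).2
  have hga := (hg.self_of_nhdsWithin self_mem_Ici).2
  have hfs : ∀ᶠ t in 𝓝[≥] a, f t ∈ s := hfa.eventually hs
  have hgs : ∀ᶠ t in 𝓝[≥] a, g t ∈ s := hga.eventually (hfg ▸ hs)
  obtain ⟨b, hab, hb⟩ := mem_nhdsGE_iff_exists_Icc_subset.1
    (((hf.and hg).and (hfs.and hgs)) : ∀ᶠ t in 𝓝[≥] a, _)
  have h := ODE_solution_unique_of_mem_Icc_right (v := fun _ => v) (s := fun _ => s) (f := f)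
    (g := g) (a := a) (b := b) (K := K) (fun _ _ => hK)
    (fun t ht => (hb ht).1.1.2.mono Icc_subset_Ici_self)
    (fun t ht => (hb (Ico_subset_Icc_self ht)).1.1.1)
    (fun t ht => (hb (Ico_subset_Icc_self ht)).2.1)
    (fun t ht => (hb ht).1.2.2.mono Icc_subset_Ici_self)
    (fun t ht => (hb (Ico_subset_Icc_self ht)).1.2.1)
    (fun t ht => (hb (Ico_subset_Icc_self ht)).2.2) hfg
  exact mem_nhdsGE_iff_exists_Icc_subset.2 ⟨b, hab, h⟩

theorem hasDerivAt_of_eventually_hasDerivAt {f g : ℝ → ℝ} {x : ℝ}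
    (h : ∀ᶠ y in 𝓝[≠] x, HasDerivAt f (g y) y) (hf : ContinuousAt f x)
    (hg : ContinuousAt g x) : HasDerivAt f (g x) x := by
  obtain ⟨s, hs, hsx⟩ : ∃ s ∈ 𝓝 x, ∀ y ∈ s, y ≠ x → HasDerivAt f (g y) y :=
    ⟨_, eventually_nhdsWithin_iff.1 h, fun y hy hyx => hy hyx⟩
  have hne : ∀ {u : Set ℝ}, u ⊆ {x}ᶜ → ∀ y ∈ u ∩ s, HasDerivAt f (g y) y :=
    fun hu y hy => hsx y hy.2 (hu hy.1)
  have key : ∀ {u : Set ℝ}, u ⊆ {x}ᶜ → Tendsto (deriv f) (𝓝[u] x) (𝓝 (g x)) := by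
    intro u hu
    refine (hg.mono_left nhdsWithin_le_nhds).congr' ?_
    filter_upwards [self_mem_nhdsWithin, mem_nhdsWithin_of_mem_nhds hs] with y hy hys
    exact (hne hu y ⟨hy, hys⟩).deriv.symm
  have h1 : HasDerivWithinAt f (g x) (Ici x) x := by
    refine hasDerivWithinAt_Ici_of_tendsto_deriv (s := Ioi x ∩ s)
      (fun y hy => (hne (fun z hz => ne_of_gt hz) y hy).differentiableAt.differentiableWithinAt)
      hf.continuousWithinAt (inter_mem self_mem_nhdsWithin (mem_nhdsWithin_of_mem_nhds hs))
      (key fun z hz => ne_of_gt hz)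
  have h2 : HasDerivWithinAt f (g x) (Iic x) x := by
    refine hasDerivWithinAt_Iic_of_tendsto_deriv (s := Iio x ∩ s)
      (fun y hy => (hne (fun z hz => ne_of_lt hz) y hy).differentiableAt.differentiableWithinAt)
      hf.continuousWithinAt (inter_mem self_mem_nhdsWithin (mem_nhdsWithin_of_mem_nhds hs))
      (key fun z hz => ne_of_lt hz)
  simpa using h2.union h1

/-- Odd extension of `arcsinPQ p q` to `[-1, 1]`. -/
noncomputable def arcsinOddPQ (p q σ : ℝ) : ℝ :=
  ∫ s in (0:ℝ)..σ, (1 - |s| ^ q) ^ (-(1 / p))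

theorem one_sub_abs_rpow_pos {q s : ℝ} (hq : 1 < q) (hs : s ∈ Ioo (-1:ℝ) 1) :
    0 < 1 - |s| ^ q :=
  sub_pos.2 (Real.rpow_lt_one (abs_nonneg s) (abs_lt.2 hs) (by linarith))

theorem intervalIntegrable_arcsinOddPQ {p q : ℝ} (hp : 1 < p) (hq : 1 < q) :
    IntervalIntegrable (fun s : ℝ => (1 - |s| ^ q) ^ (-(1 / p))) volume (-1) 1 := by
  have hp' : 1 / p < 1 := (div_lt_one (by linarith)).2 hp
  have h1 : IntervalIntegrable (fun s : ℝ => (1 - s) ^ (-(1 / p))) volume 0 1 := by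
    have := (intervalIntegral.intervalIntegrable_rpow' (a := 1) (b := 0)
      (show -1 < -(1 / p) by linarith)).comp_sub_left 1
    simpa using this
  have h2 : IntervalIntegrable (fun s : ℝ => (1 - |s| ^ q) ^ (-(1 / p))) volume 0 1 := by
    refine h1.mono_fun' ?_ ?_
    · refine Measurable.aestronglyMeasurable ?_
      fun_prop
    · have hne : ∀ᵐ s : ℝ ∂volume.restrict (uIoc 0 1), s ≠ 1 :=
        ae_restrict_of_ae (by simp [ae_iff])
      filter_upwards [ae_restrict_mem measurableSet_uIoc, hne] with s hs hs1
      rw [uIoc_of_le zero_le_one] at hs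
      have hs' : s < 1 := lt_of_le_of_ne hs.2 hs1
      have hpos := one_sub_abs_rpow_pos hq (s := s) ⟨by linarith [hs.1], hs'⟩
      rw [Real.norm_of_nonneg (Real.rpow_nonneg hpos.le _)]
      refine Real.rpow_le_rpow_of_nonpos (by linarith) ?_
        (neg_nonpos.2 (by positivity))
      have : |s| ^ q ≤ |s| ^ (1:ℝ) :=
        Real.rpow_le_rpow_of_exponent_ge (abs_pos.2 hs.1.ne') (abs_le.2 ⟨by linarith [hs.1], hs.2⟩)
          hq.le
      rw [Real.rpow_one, abs_of_pos hs.1] at this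
      rw [abs_of_pos hs.1]
      linarith
  have h3 : IntervalIntegrable (fun s : ℝ => (1 - |s| ^ q) ^ (-(1 / p))) volume (-1) 0 := by
    have := ((IntervalIntegrable.iff_comp_neg (by simp)).1 h2).symm
    simpa using this
  exact h3.trans h2

theorem arcsinOddPQ_neg (p q σ : ℝ) : arcsinOddPQ p q (-σ) = -arcsinOddPQ p q σ := by
  unfold arcsinOddPQ
  rw [intervalIntegral.integral_symm (-σ) 0]
  have := intervalIntegral.integral_comp_neg (a := 0) (b := σ)
    (fun s : ℝ => (1 - |s| ^ q) ^ (-(1 / p)))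
  simp only [abs_neg, neg_zero] at this
  rw [this]

theorem arcsinOddPQ_eq {p q σ : ℝ} (hσ : 0 ≤ σ) : arcsinOddPQ p q σ = arcsinPQ p q σ := by
  refine intervalIntegral.integral_congr fun s hs => ?_
  rw [uIcc_of_le hσ] at hs
  simp only [abs_of_nonneg hs.1]

theorem continuousOn_arcsinOddPQ {p q : ℝ} (hp : 1 < p) (hq : 1 < q) :
    ContinuousOn (arcsinOddPQ p q) (Icc (-1) 1) := by
  have := intervalIntegral.continuousOn_primitive_interval' (a := 0)
    (intervalIntegrable_arcsinOddPQ hp hq) (by rw [uIcc_of_le] <;> norm_num)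
  rwa [uIcc_of_le (by norm_num)] at this

theorem hasDerivAt_arcsinOddPQ {p q σ : ℝ} (hp : 1 < p) (hq : 1 < q) (hσ : σ ∈ Ioo (-1:ℝ) 1) :
    HasDerivAt (arcsinOddPQ p q) ((1 - |σ| ^ q) ^ (-(1 / p))) σ := by
  refine intervalIntegral.integral_hasDerivAt_right
    ((intervalIntegrable_arcsinOddPQ hp hq).mono_set ?_) ?_ ?_
  · rw [uIcc_of_le (show (-1:ℝ) ≤ 1 by norm_num)]
    exact uIcc_subset_Icc ⟨by norm_num, by norm_num⟩ (Ioo_subset_Icc_self hσ)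
  · refine (Measurable.stronglyMeasurable ?_).stronglyMeasurableAtFilter
    fun_prop
  · refine ContinuousAt.rpow_const ?_ (Or.inl (one_sub_abs_rpow_pos hq hσ).ne')
    exact continuousAt_const.sub (contDiff_abs_rpow hq).continuous.continuousAt

theorem strictMonoOn_arcsinOddPQ {p q : ℝ} (hp : 1 < p) (hq : 1 < q) :
    StrictMonoOn (arcsinOddPQ p q) (Icc (-1) 1) := by
  refine strictMonoOn_of_deriv_pos (convex_Icc _ _) (continuousOn_arcsinOddPQ hp hq) ?_
  intro σ hσ
  rw [interior_Icc] at hσ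
  rw [(hasDerivAt_arcsinOddPQ hp hq hσ).deriv]
  exact Real.rpow_pos_of_pos (one_sub_abs_rpow_pos hq hσ) _

theorem arcsinOddPQ_zero (p q : ℝ) : arcsinOddPQ p q 0 = 0 :=
  intervalIntegral.integral_same

theorem arcsinOddPQ_one (p q : ℝ) : arcsinOddPQ p q 1 = piPQ p q / 2 := by
  rw [arcsinOddPQ_eq zero_le_one, piPQ]; ring

theorem arcsinOddPQ_neg_one (p q : ℝ) : arcsinOddPQ p q (-1) = -(piPQ p q / 2) := by
  rw [arcsinOddPQ_neg, arcsinOddPQ_one]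

theorem piPQ_pos {p q : ℝ} (hp : 1 < p) (hq : 1 < q) : 0 < piPQ p q := by
  have := strictMonoOn_arcsinOddPQ hp hq (a := 0) (b := 1) (by constructor <;> norm_num)
    (by constructor <;> norm_num) one_pos
  rw [arcsinOddPQ_zero, arcsinOddPQ_one] at this
  linarith

/-- The properties that characterize `sin_{pq}`. -/
structure IsSinPQ (p q : ℝ) (S : ℝ → ℝ) : Prop where
  inv : ∀ σ ∈ Icc (0:ℝ) 1, S (arcsinPQ p q σ) = σ
  refl : ∀ t ∈ Icc (piPQ p q / 2) (piPQ p q), S t = S (piPQ p q - t)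
  odd : ∀ t : ℝ, S (-t) = - S t
  per : ∀ t : ℝ, S (t + 2 * piPQ p q) = S t

namespace IsSinPQ

variable {p q : ℝ} {S : ℝ → ℝ}

theorem map_zero (h : IsSinPQ p q S) : S 0 = 0 := by
  have := h.odd 0
  rw [neg_zero] at this
  linarith

theorem leftInv (h : IsSinPQ p q S) {σ : ℝ} (hσ : σ ∈ Icc (-1:ℝ) 1) :
    S (arcsinOddPQ p q σ) = σ := by
  rcases le_total 0 σ with h0 | h0
  · rw [arcsinOddPQ_eq h0, h.inv σ ⟨h0, hσ.2⟩]
  · rw [← neg_neg σ, arcsinOddPQ_neg, h.odd, arcsinOddPQ_eq (neg_nonneg.2 h0),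
      h.inv _ ⟨neg_nonneg.2 h0, by linarith [hσ.1]⟩]

theorem exists_arcsin (hp : 1 < p) (hq : 1 < q) {t : ℝ}
    (ht : t ∈ Icc (-(piPQ p q / 2)) (piPQ p q / 2)) :
    ∃ σ ∈ Icc (-1:ℝ) 1, arcsinOddPQ p q σ = t := by
  have := intermediate_value_Icc (by norm_num : (-1:ℝ) ≤ 1) (continuousOn_arcsinOddPQ hp hq)
  rw [arcsinOddPQ_one, arcsinOddPQ_neg_one] at this
  exact this ht

theorem mem_Icc (h : IsSinPQ p q S) (hp : 1 < p) (hq : 1 < q) {t : ℝ}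
    (ht : t ∈ Icc (-(piPQ p q / 2)) (piPQ p q / 2)) : S t ∈ Icc (-1:ℝ) 1 := by
  obtain ⟨σ, hσ, rfl⟩ := exists_arcsin hp hq ht
  rwa [h.leftInv hσ]

theorem arcsin_map (h : IsSinPQ p q S) (hp : 1 < p) (hq : 1 < q) {t : ℝ}
    (ht : t ∈ Icc (-(piPQ p q / 2)) (piPQ p q / 2)) : arcsinOddPQ p q (S t) = t := by
  obtain ⟨σ, hσ, rfl⟩ := exists_arcsin hp hq ht
  rw [h.leftInv hσ]

theorem map_pi_div_two (h : IsSinPQ p q S) : S (piPQ p q / 2) = 1 := by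
  rw [← arcsinOddPQ_one, h.leftInv (by norm_num)]

theorem mem_Ioo (h : IsSinPQ p q S) (hp : 1 < p) (hq : 1 < q) {t : ℝ}
    (ht : t ∈ Ioo (-(piPQ p q / 2)) (piPQ p q / 2)) : S t ∈ Ioo (-1:ℝ) 1 := by
  have hm := h.mem_Icc hp hq (Ioo_subset_Icc_self ht)
  have ha := h.arcsin_map hp hq (Ioo_subset_Icc_self ht)
  refine ⟨lt_of_le_of_ne hm.1 fun he => ?_, lt_of_le_of_ne hm.2 fun he => ?_⟩
  · rw [← he, arcsinOddPQ_neg_one] at ha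
    exact ht.1.ne ha
  · rw [he, arcsinOddPQ_one] at ha
    exact ht.2.ne' ha

theorem continuousOn_Icc (h : IsSinPQ p q S) (hp : 1 < p) (hq : 1 < q) :
    ContinuousOn S (Icc (-(piPQ p q / 2)) (piPQ p q / 2)) := by
  rw [continuousOn_iff_isClosed]
  intro F hF
  refine ⟨arcsinOddPQ p q '' (Icc (-1) 1 ∩ F), ?_, ?_⟩
  · exact ((isCompact_Icc.inter_right hF).image_of_continuousOn
      ((continuousOn_arcsinOddPQ hp hq).mono inter_subset_left)).isClosed
  · ext t
    constructor
    · rintro ⟨htF, ht⟩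
      exact ⟨⟨S t, ⟨h.mem_Icc hp hq ht, htF⟩, h.arcsin_map hp hq ht⟩, ht⟩
    · rintro ⟨⟨σ, ⟨hσ, hσF⟩, rfl⟩, ht⟩
      refine ⟨?_, ht⟩
      rwa [mem_preimage, h.leftInv hσ]

theorem antiperiodic (h : IsSinPQ p q S) (hp : 1 < p) (hq : 1 < q) :
    Function.Antiperiodic S (piPQ p q) := by
  have hpi := piPQ_pos hp hq
  have h1 : ∀ t ∈ Icc 0 (piPQ p q), S (piPQ p q - t) = S t := by
    intro t ht
    rcases le_total t (piPQ p q / 2) with h2 | h2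
    · rw [h.refl _ ⟨by linarith, by linarith [ht.1]⟩, sub_sub_cancel]
    · rw [h.refl _ ⟨h2, ht.2⟩]
  have h2 : ∀ t ∈ Ioc (-piPQ p q) (-piPQ p q + 2 * piPQ p q), S (t + piPQ p q) + S t = 0 := by
    intro t ht
    rcases le_total t 0 with h0 | h0
    · have := h1 (-t) ⟨by linarith, by linarith [ht.1]⟩
      rw [h.odd, sub_neg_eq_add, add_comm] at this
      rw [this]; ring
    · have := h1 t ⟨h0, by linarith [ht.2]⟩
      have h3 := h.odd (piPQ p q - t)
      rw [show -(piPQ p q - t) = t - piPQ p q by ring, ← h.per] at h3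
      rw [show t - piPQ p q + 2 * piPQ p q = t + piPQ p q by ring, this] at h3
      rw [h3]; ring
  have hper : Function.Periodic (fun t => S (t + piPQ p q) + S t) (2 * piPQ p q) := by
    intro t
    simp only
    rw [h.per, add_right_comm, h.per]
  intro t
  obtain ⟨y, hy, hty⟩ := hper.exists_mem_Ioc (by linarith) t (-piPQ p q)
  simp only [h2 y hy] at hty
  linarith

theorem map_pi_sub (h : IsSinPQ p q S) (hp : 1 < p) (hq : 1 < q) (t : ℝ) :
    S (piPQ p q - t) = S t := by
  rw [sub_eq_neg_add, h.antiperiodic hp hq, h.odd, neg_neg]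

theorem continuousAt (h : IsSinPQ p q S) (hp : 1 < p) (hq : 1 < q) {t : ℝ}
    (ht : t ∈ Ioo (-(piPQ p q / 2)) (3 * piPQ p q / 2)) : ContinuousAt S t := by
  have hc := h.continuousOn_Icc hp hq
  have hc2 : ContinuousOn S (Icc (piPQ p q / 2) (3 * piPQ p q / 2)) := by
    have : ContinuousOn (fun t => S (piPQ p q - t)) (Icc (piPQ p q / 2) (3 * piPQ p q / 2)) :=
      hc.comp (by fun_prop) fun t ht => ⟨by linarith [ht.2], by linarith [ht.1]⟩
    simpa only [h.map_pi_sub hp hq] using this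
  have hpi := piPQ_pos hp hq
  have := hc.union_of_isClosed hc2 isClosed_Icc isClosed_Icc
  rw [Icc_union_Icc_eq_Icc (by linarith) (by linarith)] at this
  exact this.continuousAt (Icc_mem_nhds ht.1 ht.2)

theorem hasDerivAt_of_mem_Ioo (h : IsSinPQ p q S) (hp : 1 < p) (hq : 1 < q) {t : ℝ}
    (ht : t ∈ Ioo (-(piPQ p q / 2)) (piPQ p q / 2)) :
    HasDerivAt S ((1 - |S t| ^ q) ^ (1 / p)) t := by
  have hm := h.mem_Ioo hp hq ht
  have hpos := one_sub_abs_rpow_pos hq hm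
  have := HasDerivAt.of_local_left_inverse
    (h.continuousAt hp hq ⟨ht.1, by linarith [ht.2, piPQ_pos hp hq]⟩)
    (hasDerivAt_arcsinOddPQ hp hq hm) (Real.rpow_pos_of_pos hpos _).ne' ?_
  · rwa [Real.rpow_neg hpos.le, inv_inv] at this
  · filter_upwards [Ioo_mem_nhds ht.1 ht.2] with y hy
    exact h.arcsin_map hp hq (Ioo_subset_Icc_self hy)

theorem deriv_pi_sub (h : IsSinPQ p q S) (hp : 1 < p) (hq : 1 < q) (t : ℝ) :
    deriv S (piPQ p q - t) = -deriv S t := by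
  have : deriv (fun x => S (piPQ p q - x)) t = -deriv S (piPQ p q - t) :=
    deriv_comp_const_sub ..
  simp only [h.map_pi_sub hp hq] at this
  rw [this, neg_neg]

theorem hasDerivAt_of_pi_sub (h : IsSinPQ p q S) (hp : 1 < p) (hq : 1 < q) {t : ℝ}
    (ht : HasDerivAt S (deriv S (piPQ p q - t)) (piPQ p q - t)) : HasDerivAt S (deriv S t) t := by
  have := HasDerivAt.comp_const_sub (piPQ p q) t ht
  rw [h.deriv_pi_sub hp hq, neg_neg] at this
  simpa only [h.map_pi_sub hp hq] using this

/-- `S` is differentiable at `t` and solves the normalized equation there. -/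
def SolvesAt (p q : ℝ) (S : ℝ → ℝ) (t : ℝ) : Prop :=
  HasDerivAt S (deriv S t) t ∧
    HasDerivAt (fun s => phi p (deriv S s)) (-(q / (p / (p - 1)) * phi q (S t))) t

theorem solvesAt_of_mem_Ioo (h : IsSinPQ p q S) (hp : 1 < p) (hq : 1 < q) {t : ℝ}
    (ht : t ∈ Ioo (-(piPQ p q / 2)) (piPQ p q / 2)) : SolvesAt p q S t := by
  have hd := h.hasDerivAt_of_mem_Ioo hp hq ht
  refine ⟨hd.differentiableAt.hasDerivAt, ?_⟩
  have hp0 : 0 < p := by linarith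
  have hpos := one_sub_abs_rpow_pos hq (h.mem_Ioo hp hq ht)
  have hev : (fun s => phi p (deriv S s)) =ᶠ[𝓝 t] fun s => (1 - |S s| ^ q) ^ ((p - 1) / p) := by
    filter_upwards [Ioo_mem_nhds ht.1 ht.2] with s hs
    have hps := one_sub_abs_rpow_pos hq (h.mem_Ioo hp hq hs)
    rw [(h.hasDerivAt_of_mem_Ioo hp hq hs).deriv,
      phi_of_nonneg hp (Real.rpow_nonneg hps.le _), ← Real.rpow_mul hps.le]
    congr 1
    ring
  refine HasDerivAt.congr_of_eventuallyEq ?_ hev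
  have h1 := ((((hasDerivAt_abs_rpow_phi hq (S t)).comp t hd).const_sub 1).rpow_const
    (p := (p - 1) / p) (Or.inl hpos.ne'))
  refine h1.congr_deriv ?_
  have h2 : (1 - |S t| ^ q) ^ (1 / p) * (1 - |S t| ^ q) ^ ((p - 1) / p - 1) = 1 := by
    rw [← Real.rpow_add hpos]
    rw [show 1 / p + ((p - 1) / p - 1) = 0 by field_simp; ring, Real.rpow_zero]
  simp only [Function.comp]
  calc _ = -(q * ((p - 1) / p) * phi q (S t)) *
      ((1 - |S t| ^ q) ^ (1 / p) * (1 - |S t| ^ q) ^ ((p - 1) / p - 1)) := by ring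
    _ = _ := by
      have : p - 1 ≠ 0 := by linarith
      rw [h2]; field_simp

theorem solvesAt_of_pi_sub (h : IsSinPQ p q S) (hp : 1 < p) (hq : 1 < q) {t : ℝ}
    (ht : SolvesAt p q S (piPQ p q - t)) : SolvesAt p q S t := by
  refine ⟨h.hasDerivAt_of_pi_sub hp hq ht.1, ?_⟩
  have := HasDerivAt.comp_const_sub (piPQ p q) t ht.2
  simp only [h.deriv_pi_sub hp hq, phi_neg, h.map_pi_sub hp hq] at this
  simpa only [neg_neg, mul_neg] using this.fun_neg

theorem solvesAt_pi_div_two (h : IsSinPQ p q S) (hp : 1 < p) (hq : 1 < q) :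
    SolvesAt p q S (piPQ p q / 2) := by
  have hpi := piPQ_pos hp hq
  have hp0 : 0 < p := by linarith
  have hcont := h.continuousAt hp hq (t := piPQ p q / 2) ⟨by linarith, by linarith⟩
  have hnhds : Ioo (-(piPQ p q / 2)) (3 * piPQ p q / 2) ∈ 𝓝 (piPQ p q / 2) :=
    Ioo_mem_nhds (by linarith) (by linarith)
  have hne : ∀ᶠ t in 𝓝[≠] (piPQ p q / 2),
      SolvesAt p q S t ∧ |deriv S t| = (1 - |S t| ^ q) ^ (1 / p) := by
    filter_upwards [self_mem_nhdsWithin, mem_nhdsWithin_of_mem_nhds hnhds] with t ht htI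
    rcases lt_or_gt_of_ne (show t ≠ piPQ p q / 2 from ht) with hlt | hgt
    · refine ⟨h.solvesAt_of_mem_Ioo hp hq ⟨htI.1, hlt⟩, ?_⟩
      rw [(h.hasDerivAt_of_mem_Ioo hp hq ⟨htI.1, hlt⟩).deriv, abs_of_nonneg]
      exact Real.rpow_nonneg (one_sub_abs_rpow_pos hq (h.mem_Ioo hp hq ⟨htI.1, hlt⟩)).le _
    · have hm : piPQ p q - t ∈ Ioo (-(piPQ p q / 2)) (piPQ p q / 2) :=
        ⟨by linarith [htI.2], by linarith⟩
      refine ⟨h.solvesAt_of_pi_sub hp hq (h.solvesAt_of_mem_Ioo hp hq hm), ?_⟩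
      rw [← abs_neg, ← h.deriv_pi_sub hp hq, (h.hasDerivAt_of_mem_Ioo hp hq hm).deriv,
        h.map_pi_sub hp hq, abs_of_nonneg]
      rw [← h.map_pi_sub hp hq t]
      exact Real.rpow_nonneg (one_sub_abs_rpow_pos hq (h.mem_Ioo hp hq hm)).le _
  have hlim : Tendsto (fun t => (1 - |S t| ^ q) ^ (1 / p)) (𝓝 (piPQ p q / 2)) (𝓝 0) := by
    have h1 : ContinuousAt (fun t => (1 - |S t| ^ q) ^ (1 / p)) (piPQ p q / 2) := by
      refine ContinuousAt.rpow_const ?_ (Or.inr (by positivity))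
      exact continuousAt_const.sub
        ((contDiff_abs_rpow hq).continuous.continuousAt.comp hcont)
    have h2 := h1.tendsto
    rwa [h.map_pi_div_two, abs_one, Real.one_rpow, sub_self,
      Real.zero_rpow (by positivity)] at h2
  have hlim' : Tendsto (deriv S) (𝓝[≠] (piPQ p q / 2)) (𝓝 0) := by
    rw [tendsto_zero_iff_abs_tendsto_zero]
    refine (hlim.mono_left nhdsWithin_le_nhds).congr' ?_
    filter_upwards [hne] with t ht
    exact ht.2.symm
  have hzero : deriv S (piPQ p q / 2) = 0 := by
    have := h.deriv_pi_sub hp hq (piPQ p q / 2)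
    rw [sub_half] at this
    linarith
  have hdc : ContinuousAt (deriv S) (piPQ p q / 2) := by
    rw [continuousAt_iff_punctured_nhds, hzero]
    exact hlim'
  refine ⟨hasDerivAt_of_eventually_hasDerivAt (hne.mono fun t ht => ht.1.1) hcont hdc, ?_⟩
  refine hasDerivAt_of_eventually_hasDerivAt (g := fun t => -(q / (p / (p - 1)) * phi q (S t)))
    (hne.mono fun t ht => ht.1.2) ?_ ?_
  · exact (continuous_phi hp).continuousAt.comp hdc
  · exact (continuousAt_const.mul ((continuous_phi hq).continuousAt.comp hcont)).neg

theorem SolvesAt.add {c t : ℝ} (ht : SolvesAt p q S t)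
    (hc : Function.Antiperiodic S c) : SolvesAt p q S (t + c) := by
  have hdc : ∀ x, deriv S (x - c) = -deriv S x := by
    intro x
    have : deriv (fun x => S (x - c)) x = deriv S (x - c) := deriv_comp_sub_const ..
    simp only [hc.sub_eq] at this
    rw [← this, deriv.fun_neg]
  have h1 := HasDerivAt.comp_sub_const (t + c) c (f := S) (f' := deriv S t)
    (by rw [add_sub_cancel_right]; exact ht.1)
  have h2 := HasDerivAt.comp_sub_const (t + c) c (f := fun s => phi p (deriv S s))
    (by rw [add_sub_cancel_right]; exact ht.2)
  have h3 := hdc (t + c)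
  rw [add_sub_cancel_right] at h3
  simp only [hdc, hc.sub_eq, phi_neg] at h1 h2
  constructor
  · have := h1.fun_neg
    rw [h3] at this
    simpa only [neg_neg] using this
  · have := h2.fun_neg
    rw [hc t, phi_neg]
    simpa only [neg_neg, mul_neg] using this

theorem solvesAt (h : IsSinPQ p q S) (hp : 1 < p) (hq : 1 < q) (t : ℝ) : SolvesAt p q S t := by
  have hpi := piPQ_pos hp hq
  have hanti := h.antiperiodic hp hq
  have hper : Function.Periodic (SolvesAt p q S) (piPQ p q) := by
    intro x
    refine propext ⟨fun hx => ?_, fun hx => hx.add hanti⟩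
    have := hx.add hanti.neg
    rwa [add_neg_cancel_right] at this
  obtain ⟨y, hy, hty⟩ := hper.exists_mem_Ioc hpi t (-(piPQ p q / 2))
  rw [hty]
  rcases hy.2.lt_or_eq with hlt | heq
  · exact h.solvesAt_of_mem_Ioo hp hq ⟨hy.1, by linarith⟩
  · rw [heq, show -(piPQ p q / 2) + piPQ p q = piPQ p q / 2 by ring]
    exact h.solvesAt_pi_div_two hp hq

theorem deriv_zero (h : IsSinPQ p q S) (hp : 1 < p) (hq : 1 < q) : deriv S 0 = 1 := by
  have hpi := piPQ_pos hp hq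
  rw [(h.hasDerivAt_of_mem_Ioo hp hq (t := 0) ⟨by linarith, by linarith⟩).deriv, h.map_zero,
    abs_zero, Real.zero_rpow (by linarith), sub_zero, Real.one_rpow]

theorem continuous_deriv (h : IsSinPQ p q S) (hp : 1 < p) (hq : 1 < q) :
    Continuous (deriv S) := by
  have h1 : Continuous (fun t => phi p (deriv S t)) :=
    continuous_iff_continuousAt.2 fun t => (h.solvesAt hp hq t).2.continuousAt
  exact ((continuous_phi (one_lt_div_sub_one hp)).comp h1).congr fun t => phi_conj_phi hp _

theorem map_nat_mul_pi (h : IsSinPQ p q S) (hp : 1 < p) (hq : 1 < q) (n : ℕ) :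
    S (n * piPQ p q) = 0 := by
  induction n with
  | zero => simpa using h.map_zero
  | succ n ih =>
    rw [Nat.cast_succ, add_one_mul, h.antiperiodic hp hq, ih, neg_zero]

theorem exists_nat_of_map_eq_zero (h : IsSinPQ p q S) (hp : 1 < p) (hq : 1 < q) {x : ℝ}
    (hx : 0 < x) (hSx : S x = 0) : ∃ n : ℕ, 1 ≤ n ∧ x = n * piPQ p q := by
  have hpi := piPQ_pos hp hq
  have hper : Function.Periodic (fun t => S t = 0) (piPQ p q) := by
    intro t
    simp only [h.antiperiodic hp hq t, neg_eq_zero]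
  obtain ⟨m, hm, -⟩ := existsUnique_add_zsmul_mem_Ioc hpi x (-(piPQ p q / 2))
  have h0 : S (x + m • piPQ p q) = 0 := (iff_of_eq (hper.zsmul m x)).2 hSx
  have h1 := h.arcsin_map hp hq (t := x + m • piPQ p q) ⟨hm.1.le, by linarith [hm.2]⟩
  rw [h0, arcsinOddPQ_zero, zsmul_eq_mul] at h1
  have h2 : x = ((-m : ℤ) : ℝ) * piPQ p q := by push_cast; linarith
  have h3 : 0 < -m := by
    by_contra hcon
    have : ((-m : ℤ) : ℝ) ≤ 0 := by exact_mod_cast not_lt.1 hcon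
    nlinarith
  obtain ⟨n, hn⟩ := Int.eq_ofNat_of_zero_le h3.le
  refine ⟨n, by omega, ?_⟩
  rw [h2, hn, Int.cast_natCast]

end IsSinPQ

/-- `(u, c)` solves the first-order system `u' = c`, `(φ_p(c))' = -λ φ_q(u)` on `[0, T]`. -/
structure IsFlow (p q T lam : ℝ) (u c : ℝ → ℝ) : Prop where
  hasDeriv : ∀ t ∈ Icc 0 T, HasDerivWithinAt u (c t) (Icc 0 T) t
  continuousOn : ContinuousOn c (Icc 0 T)
  hasDeriv_phi : ∀ t ∈ Ioo 0 T, HasDerivAt (fun s => phi p (c s)) (-(lam * phi q (u t))) t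

theorem isSolE_iff {p q T lam : ℝ} {u : ℝ → ℝ} :
    IsSolE p q T lam u ↔ ∃ c, IsFlow p q T lam u c ∧ u 0 = 0 ∧ u T = 0 := by
  constructor
  · rintro ⟨c, h1, h2, h3, h4⟩
    exact ⟨c, ⟨h1, h2, fun t ht => (h3 t ht).hasDerivAt (isOpen_Ioo.mem_nhds ht)⟩, h4⟩
  · rintro ⟨c, ⟨h1, h2, h3⟩, h4⟩
    exact ⟨c, h1, h2, fun t ht => (h3 t ht).hasDerivWithinAt, h4⟩

namespace IsFlow

variable {p q T lam : ℝ} {u c : ℝ → ℝ}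

theorem neg (h : IsFlow p q T lam u c) :
    IsFlow p q T lam (fun t => -u t) (fun t => -c t) := by
  refine ⟨fun t ht => (h.hasDeriv t ht).fun_neg, h.continuousOn.fun_neg, fun t ht => ?_⟩
  simp only [phi_neg, mul_neg]
  simpa only [neg_neg] using (h.hasDeriv_phi t ht).fun_neg

theorem continuousOn_fst (h : IsFlow p q T lam u c) : ContinuousOn u (Icc 0 T) :=
  fun t ht => (h.hasDeriv t ht).continuousWithinAt

theorem energy_eq (h : IsFlow p q T lam u c) (hp : 1 < p) (hq : 1 < q) {t : ℝ}
    (ht : t ∈ Icc 0 T) :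
    |c t| ^ p + lam * (p / (p - 1)) / q * |u t| ^ q =
      |c 0| ^ p + lam * (p / (p - 1)) / q * |u 0| ^ q := by
  rcases ht.1.eq_or_lt with rfl | h0
  · rfl
  have hconj := one_lt_div_sub_one hp
  have hsub : Icc 0 t ⊆ Icc 0 T := Icc_subset_Icc_right ht.2
  have hcont : ContinuousOn (fun t => |c t| ^ p + lam * (p / (p - 1)) / q * |u t| ^ q)
      (Icc 0 t) :=
    ((contDiff_abs_rpow hp).continuous.comp_continuousOn (h.continuousOn.mono hsub)).add
      (continuousOn_const.mul
        ((contDiff_abs_rpow hq).continuous.comp_continuousOn (h.continuousOn_fst.mono hsub)))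
  obtain ⟨x, -, hx⟩ := exists_hasDerivAt_eq_slope _ (fun _ => 0) h0 hcont fun s hs => by
    have hsT : s ∈ Ioo 0 T := ⟨hs.1, hs.2.trans_le ht.2⟩
    have h1 := (hasDerivAt_abs_rpow_phi hconj (phi p (c s))).comp s (h.hasDeriv_phi s hsT)
    have h2 := (hasDerivAt_abs_rpow_phi hq (u s)).comp s
      ((h.hasDeriv s (Ioo_subset_Icc_self hsT)).hasDerivAt (Icc_mem_nhds hsT.1 hsT.2))
    have h3 := h1.add (h2.const_mul (lam * (p / (p - 1)) / q))
    rw [phi_conj_phi hp] at h3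
    simp only [Function.comp_def, Pi.add_def, abs_phi_rpow_conj hp] at h3
    refine h3.congr_deriv ?_
    have : q ≠ 0 := by linarith
    field_simp
    ring
  rw [eq_div_iff (by linarith : t - 0 ≠ 0), zero_mul] at hx
  linarith

theorem eventually_velocity_eq (h : IsFlow p q T lam u c) (hp : 1 < p) {E k t₀ : ℝ}
    (hE : ∀ t ∈ Icc 0 T, |c t| ^ p + k * |u t| ^ q = E) (ht₀ : t₀ ∈ Ico 0 T) (hc : c t₀ ≠ 0) :
    ∀ᶠ t in 𝓝[≥] t₀, c t = Real.sign (c t₀) * (E - k * |u t| ^ q) ^ (1 / p) := by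
  have hIcc : Icc 0 T ∈ 𝓝[≥] t₀ :=
    mem_of_superset (Icc_mem_nhdsGE ht₀.2) (Icc_subset_Icc_left ht₀.1)
  filter_upwards [hIcc, eventually_sign_eq
    ((h.continuousOn t₀ (Ico_subset_Icc_self ht₀)).mono_of_mem_nhdsWithin hIcc) hc] with t ht hs
  rw [← hE t ht, add_sub_cancel_right, ← Real.rpow_mul (abs_nonneg _),
    mul_one_div_cancel (by linarith), Real.rpow_one, ← hs, sign_mul_abs_self]

theorem eventually_position_eq (h : IsFlow p q T lam u c) (hp : 1 < p) (hq : 1 < q) {E k t₀ : ℝ}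
    (hk : 0 < k) (hE : ∀ t ∈ Icc 0 T, |c t| ^ p + k * |u t| ^ q = E) (ht₀ : t₀ ∈ Ico 0 T)
    (hu : u t₀ ≠ 0) :
    ∀ᶠ t in 𝓝[≥] t₀,
      u t = Real.sign (u t₀) * ((E - |phi p (c t)| ^ (p / (p - 1))) / k) ^ (1 / q) := by
  have hIcc : Icc 0 T ∈ 𝓝[≥] t₀ :=
    mem_of_superset (Icc_mem_nhdsGE ht₀.2) (Icc_subset_Icc_left ht₀.1)
  filter_upwards [hIcc, eventually_sign_eq
    ((h.continuousOn_fst t₀ (Ico_subset_Icc_self ht₀)).mono_of_mem_nhdsWithin hIcc) hu]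
    with t ht hs
  rw [abs_phi_rpow_conj hp, ← hE t ht, add_sub_cancel_left, mul_div_cancel_left₀ _ hk.ne',
    ← Real.rpow_mul (abs_nonneg _),
    mul_one_div_cancel (by linarith), Real.rpow_one, ← hs, sign_mul_abs_self]

theorem eventually_hasDeriv_fst (h : IsFlow p q T lam u c) (hp : 1 < p) {E k t₀ : ℝ}
    (hE : ∀ t ∈ Icc 0 T, |c t| ^ p + k * |u t| ^ q = E) (ht₀ : t₀ ∈ Ico 0 T) (hc : c t₀ ≠ 0) :
    ∀ᶠ t in 𝓝[≥] t₀,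
      HasDerivWithinAt u (Real.sign (c t₀) * (E - k * |u t| ^ q) ^ (1 / p)) (Ici t) t ∧
        ContinuousWithinAt u (Ici t₀) t := by
  filter_upwards [h.eventually_velocity_eq hp hE ht₀ hc, Ico_mem_nhdsGE ht₀.2] with t ht htT
  have htI : t ∈ Icc 0 T := ⟨ht₀.1.trans htT.1, htT.2.le⟩
  rw [← ht]
  refine ⟨(h.hasDeriv t htI).mono_of_mem_nhdsWithin
    (mem_of_superset (Icc_mem_nhdsGE htT.2) (Icc_subset_Icc_left htI.1)),
    (h.continuousOn_fst t htI).mono_of_mem_nhdsWithin ?_⟩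
  filter_upwards [self_mem_nhdsWithin, mem_nhdsWithin_of_mem_nhds (Iio_mem_nhds htT.2)] with s h1 h2
  exact ⟨ht₀.1.trans h1, (show s < T from h2).le⟩

theorem eventually_hasDeriv_phi (h : IsFlow p q T lam u c) (hp : 1 < p) (hq : 1 < q)
    {E k t₀ : ℝ} (hk : 0 < k)
    (hE : ∀ t ∈ Icc 0 T, |c t| ^ p + k * |u t| ^ q = E) (ht₀ : t₀ ∈ Ioo 0 T) (hu : u t₀ ≠ 0) :
    ∀ᶠ t in 𝓝[≥] t₀,
      HasDerivWithinAt (fun s => phi p (c s)) (-(lam * phi q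
        (Real.sign (u t₀) * ((E - |phi p (c t)| ^ (p / (p - 1))) / k) ^ (1 / q)))) (Ici t) t ∧
        ContinuousWithinAt (fun s => phi p (c s)) (Ici t₀) t := by
  filter_upwards [h.eventually_position_eq hp hq hk hE (Ioo_subset_Ico_self ht₀) hu,
    mem_nhdsWithin_of_mem_nhds (Ioo_mem_nhds ht₀.1 ht₀.2)] with t ht htT
  rw [← ht]
  exact ⟨(h.hasDeriv_phi t htT).hasDerivWithinAt,
    (h.hasDeriv_phi t htT).continuousAt.continuousWithinAt⟩

variable {v d : ℝ → ℝ}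

theorem eventually_eq (h₁ : IsFlow p q T lam u c) (h₂ : IsFlow p q T lam v d) (hp : 1 < p)
    (hq : 1 < q) {E k t₀ : ℝ} (hk : 0 < k) (hEpos : 0 < E)
    (hE₁ : ∀ t ∈ Icc 0 T, |c t| ^ p + k * |u t| ^ q = E)
    (hE₂ : ∀ t ∈ Icc 0 T, |d t| ^ p + k * |v t| ^ q = E) (ht₀ : t₀ ∈ Ico 0 T)
    (hc₀ : t₀ = 0 → c t₀ ≠ 0) (huv : u t₀ = v t₀) (hcd : c t₀ = d t₀) :
    ∀ᶠ t in 𝓝[≥] t₀, u t = v t ∧ c t = d t := by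
  have hconj := one_lt_div_sub_one hp
  have hE₀ := hE₁ t₀ (Ico_subset_Icc_self ht₀)
  by_cases hc : c t₀ = 0
  · have ht₀' : t₀ ∈ Ioo 0 T := ⟨lt_of_le_of_ne ht₀.1 fun he => hc₀ he.symm hc, ht₀.2⟩
    have hu : u t₀ ≠ 0 := by
      intro hu
      rw [hc, hu, abs_zero, Real.zero_rpow (by linarith), Real.zero_rpow (by linarith)] at hE₀
      linarith
    have hphi₀ : phi p (c t₀) = 0 := by rw [hc, phi_zero]
    have hsmooth : ContDiffAt ℝ 1 (fun w => -(lam * phi q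
        (Real.sign (u t₀) * ((E - |w| ^ (p / (p - 1))) / k) ^ (1 / q)))) (phi p (c t₀)) := by
      have hpos : ∀ᶠ w in 𝓝 (0:ℝ), 0 < (E - |w| ^ (p / (p - 1))) / k := by
        have : ContinuousAt (fun w : ℝ => (E - |w| ^ (p / (p - 1))) / k) 0 :=
          (continuous_const.sub (contDiff_abs_rpow hconj).continuous).div_const _ |>.continuousAt
        refine this.eventually_const_lt ?_
        simp only [abs_zero]
        rw [Real.zero_rpow (by linarith), sub_zero]
        positivity
      have hEq : (fun w => -(lam * phi q
          (Real.sign (u t₀) * ((E - |w| ^ (p / (p - 1))) / k) ^ (1 / q)))) =ᶠ[𝓝 (0:ℝ)]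
          fun w => -(lam * (Real.sign (u t₀) *
            ((E - |w| ^ (p / (p - 1))) / k) ^ ((q - 1) / q))) := by
        filter_upwards [hpos] with w hw
        have hw' := Real.rpow_pos_of_pos hw (1 / q)
        have : phi q (Real.sign (u t₀) * ((E - |w| ^ (p / (p - 1))) / k) ^ (1 / q)) =
            Real.sign (u t₀) * phi q (((E - |w| ^ (p / (p - 1))) / k) ^ (1 / q)) := by
          rcases Real.sign_apply_eq_of_ne_zero _ hu with hs | hs <;> rw [hs] <;> simp [phi_neg]
        rw [this, phi_of_nonneg hq hw'.le, ← Real.rpow_mul hw.le]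
        ring_nf
      rw [hphi₀]
      refine ContDiffAt.congr_of_eventuallyEq ?_ hEq
      have hbase : ContDiffAt ℝ 1 (fun w : ℝ => (E - |w| ^ (p / (p - 1))) / k) 0 :=
        (contDiffAt_const.sub (contDiff_abs_rpow hconj).contDiffAt).div_const _
      exact (contDiffAt_const.mul (contDiffAt_const.mul
        (hbase.rpow_const_of_ne hpos.self_of_nhds.ne'))).neg
    have hd₂ := h₂.eventually_hasDeriv_phi hp hq hk hE₂ ht₀' (huv ▸ hu)
    rw [← huv] at hd₂
    have hpu₂ := h₂.eventually_position_eq hp hq hk hE₂ ht₀ (huv ▸ hu)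
    rw [← huv] at hpu₂
    filter_upwards [eventually_eq_of_autonomous (f := fun s => phi p (c s)) (g := fun s => phi p (d s))
      hsmooth (congrArg (phi p) hcd)
      (h₁.eventually_hasDeriv_phi hp hq hk hE₁ ht₀' hu) hd₂,
      h₁.eventually_position_eq hp hq hk hE₁ ht₀ hu, hpu₂] with t ht hu₁ hu₂
    refine ⟨by rw [hu₁, hu₂, ht], ?_⟩
    rw [← phi_conj_phi hp (c t), ht, phi_conj_phi hp]
  · have hsmooth : ContDiffAt ℝ 1
        (fun x => Real.sign (c t₀) * (E - k * |x| ^ q) ^ (1 / p)) (u t₀) := by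
      refine contDiffAt_const.mul (ContDiffAt.rpow_const_of_ne ?_ ?_)
      · exact contDiffAt_const.sub (contDiffAt_const.mul (contDiff_abs_rpow hq).contDiffAt)
      · rw [← hE₀, add_sub_cancel_right]
        exact (Real.rpow_pos_of_pos (abs_pos.2 hc) _).ne'
    have hd₂ := h₂.eventually_hasDeriv_fst hp hE₂ ht₀ (hcd ▸ hc)
    have hpc₂ := h₂.eventually_velocity_eq hp hE₂ ht₀ (hcd ▸ hc)
    rw [← hcd] at hd₂ hpc₂
    filter_upwards [eventually_eq_of_autonomous hsmooth huv
      (h₁.eventually_hasDeriv_fst hp hE₁ ht₀ hc) hd₂,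
      h₁.eventually_velocity_eq hp hE₁ ht₀ hc, hpc₂] with t ht hc₁ hc₂
    exact ⟨ht, by rw [hc₁, hc₂, ht]⟩

theorem eqOn (h₁ : IsFlow p q T lam u c) (h₂ : IsFlow p q T lam v d) (hp : 1 < p)
    (hq : 1 < q) (hlam : 0 < lam) (hu₀ : u 0 = 0) (hv₀ : v 0 = 0) (hc₀ : c 0 ≠ 0)
    (hcd : c 0 = d 0) : EqOn u v (Icc 0 T) := by
  have hk : 0 < lam * (p / (p - 1)) / q := by
    have := one_lt_div_sub_one hp
    positivity
  have hzero : |(0:ℝ)| ^ q = 0 := by rw [abs_zero, Real.zero_rpow (by linarith)]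
  have hE₁ : ∀ t ∈ Icc 0 T, |c t| ^ p + lam * (p / (p - 1)) / q * |u t| ^ q = |c 0| ^ p := by
    intro t ht
    rw [h₁.energy_eq hp hq ht, hu₀, hzero, mul_zero, add_zero]
  have hE₂ : ∀ t ∈ Icc 0 T, |d t| ^ p + lam * (p / (p - 1)) / q * |v t| ^ q = |c 0| ^ p := by
    intro t ht
    rw [h₂.energy_eq hp hq ht, hv₀, hzero, mul_zero, add_zero, hcd]
  have hsub : Icc 0 T ⊆ {t | u t = v t ∧ c t = d t} := by
    refine IsClosed.Icc_subset_of_forall_mem_nhdsWithin ?_ ⟨hu₀.trans hv₀.symm, hcd⟩ ?_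
    · have hcl : IsClosed (Icc 0 T ∩ (fun t => (u t - v t, c t - d t)) ⁻¹' {(0, 0)}) :=
        ((h₁.continuousOn_fst.sub h₂.continuousOn_fst).prodMk
          (h₁.continuousOn.sub h₂.continuousOn)).preimage_isClosed_of_isClosed isClosed_Icc
          isClosed_singleton
      convert hcl using 1
      ext t
      simp [sub_eq_zero, and_comm]
    · rintro t ⟨⟨h1, h2⟩, ht⟩
      exact nhdsWithin_mono t Ioi_subset_Ici_self
        (h₁.eventually_eq h₂ hp hq hk (Real.rpow_pos_of_pos (abs_pos.2 hc₀) p) hE₁ hE₂ ht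
          (fun h => h ▸ hc₀) h1 h2)
  exact fun t ht => (hsub ht).1

theorem velocity_ne_zero (h : IsFlow p q T lam u c) (hp : 1 < p) (hq : 1 < q) (hlam : 0 < lam)
    (hu₀ : u 0 = 0) (hne : ¬ ∀ t ∈ Icc 0 T, u t = 0) : c 0 ≠ 0 := by
  intro hc
  refine hne fun t ht => ?_
  have hk : 0 < lam * (p / (p - 1)) / q := by
    have := one_lt_div_sub_one hp
    positivity
  have hE := h.energy_eq hp hq ht
  rw [hc, hu₀, abs_zero, Real.zero_rpow (by linarith), Real.zero_rpow (by linarith)] at hE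
  by_contra hut
  have h1 := Real.rpow_pos_of_pos (abs_pos.2 hut) q
  have h2 := Real.rpow_nonneg (abs_nonneg (c t)) p
  nlinarith [mul_pos hk h1]

end IsFlow

theorem IsSinPQ.isFlow_scaled {p q : ℝ} {S : ℝ → ℝ} (h : IsSinPQ p q S) (hp : 1 < p) (hq : 1 < q)
    (T : ℝ) {R ω : ℝ} (hR : 0 < R) (hω : 0 < ω) :
    IsFlow p q T (q / (p / (p - 1)) * ω ^ p * R ^ (p - q)) (fun t => R * S (ω * t))
      (fun t => R * ω * deriv S (ω * t)) := by
  refine ⟨fun t _ => ?_, ?_, fun t _ => ?_⟩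
  · have h1 := ((h.solvesAt hp hq (ω * t)).1.comp t ((hasDerivAt_id t).const_mul ω)).const_mul R
    refine (h1.congr_deriv ?_).hasDerivWithinAt
    ring
  · exact (continuous_const.mul ((h.continuous_deriv hp hq).comp
      (continuous_const.mul continuous_id))).continuousOn
  · have h1 := ((h.solvesAt hp hq (ω * t)).2.comp t ((hasDerivAt_id t).const_mul ω)).const_mul
      ((R * ω) ^ (p - 1))
    simp only [phi_mul_of_pos p (mul_pos hR hω), phi_mul_of_pos q hR]
    refine h1.congr_deriv ?_
    rw [Real.mul_rpow hR.le hω.le, show ω ^ p = ω ^ (p - 1) * ω by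
      rw [← Real.rpow_add_one hω.ne', sub_add_cancel],
      show R ^ (p - 1) = R ^ (p - q) * R ^ (q - 1) by
        rw [← Real.rpow_add hR, sub_add_sub_cancel]]
    ring

theorem IsFlow.exists_eigenvalue {p q T lam : ℝ} {S u c : ℝ → ℝ} (h : IsFlow p q T lam u c)
    (hS : IsSinPQ p q S) (hp : 1 < p) (hq : 1 < q) (hT : 0 < T) (hlam : 0 < lam)
    (hu₀ : u 0 = 0) (huT : u T = 0) (hc₀ : 0 < c 0) :
    ∃ n : ℕ, 1 ≤ n ∧ ∃ R : ℝ, 0 < R ∧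
      lam = q / (p / (p - 1)) * ((n : ℝ) * piPQ p q / T) ^ p * R ^ (p - q) ∧
      ∀ t ∈ Icc (0:ℝ) T, u t = R * S ((n : ℝ) * piPQ p q * t / T) := by
  have hconj := one_lt_div_sub_one hp
  have hκ : 0 < q / (p / (p - 1)) := by positivity
  obtain ⟨R, hR, hRq⟩ : ∃ R : ℝ, 0 < R ∧ R ^ q = q / (p / (p - 1)) * c 0 ^ p / lam := by
    have hpos : 0 < q / (p / (p - 1)) * c 0 ^ p / lam := by
      have := Real.rpow_pos_of_pos hc₀ p
      positivity
    exact ⟨_, Real.rpow_pos_of_pos hpos (1 / q), by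
      rw [← Real.rpow_mul hpos.le, one_div_mul_cancel (by linarith), Real.rpow_one]⟩
  have hω : 0 < c 0 / R := div_pos hc₀ hR
  have hlamR : lam = q / (p / (p - 1)) * (c 0 / R) ^ p * R ^ (p - q) := by
    have h1 := Real.rpow_pos_of_pos hR p
    have h2 := Real.rpow_pos_of_pos hc₀ p
    have hp1 : p - 1 ≠ 0 := by linarith
    rw [Real.div_rpow hc₀.le hR.le, Real.rpow_sub hR, hRq]
    field_simp
  have hflow := hS.isFlow_scaled hp hq T hR hω
  rw [← hlamR] at hflow
  have heq := h.eqOn hflow hp hq hlam hu₀ (by simp [hS.map_zero]) hc₀.ne' (by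
    rw [mul_zero, hS.deriv_zero hp hq]; field_simp)
  have hST : S (c 0 / R * T) = 0 := by
    have h1 := heq ⟨hT.le, le_rfl⟩
    simp only [huT] at h1
    exact (mul_eq_zero.1 h1.symm).resolve_left hR.ne'
  obtain ⟨n, hn, hnT⟩ := hS.exists_nat_of_map_eq_zero hp hq (mul_pos hω hT) hST
  have hωn : c 0 / R = n * piPQ p q / T := by rw [← hnT, mul_div_cancel_right₀ _ hT.ne']
  refine ⟨n, hn, R, hR, by rw [← hωn]; exact hlamR, fun t ht => ?_⟩
  simp only [heq ht, hωn, div_mul_eq_mul_div]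

theorem stmt11 (p q T : ℝ) (hp : 1 < p) (hq : 1 < q) (hT : 0 < T)
    (sinpq : ℝ → ℝ)
    (hinv : ∀ σ ∈ Icc (0:ℝ) 1, sinpq (arcsinPQ p q σ) = σ)
    (hrefl : ∀ t ∈ Icc (piPQ p q / 2) (piPQ p q), sinpq t = sinpq (piPQ p q - t))
    (hodd : ∀ t : ℝ, sinpq (-t) = - sinpq t)
    (hper : ∀ t : ℝ, sinpq (t + 2 * piPQ p q) = sinpq t) :
    (∀ R : ℝ, 0 < R → ∀ n : ℕ, 1 ≤ n →
      IsSolE p q T (q / (p / (p - 1)) * ((n : ℝ) * piPQ p q / T) ^ p * R ^ (p - q))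
        (fun t => R * sinpq ((n : ℝ) * piPQ p q * t / T)) ∧
      IsSolE p q T (q / (p / (p - 1)) * ((n : ℝ) * piPQ p q / T) ^ p * R ^ (p - q))
        (fun t => -(R * sinpq ((n : ℝ) * piPQ p q * t / T))) ∧
      ¬ (∀ t ∈ Icc (0:ℝ) T, R * sinpq ((n : ℝ) * piPQ p q * t / T) = 0)) ∧
    (∀ lam : ℝ, 0 < lam → ∀ u : ℝ → ℝ, IsSolE p q T lam u →
      (¬ ∀ t ∈ Icc (0:ℝ) T, u t = 0) →
      ∃ n : ℕ, 1 ≤ n ∧ ∃ R : ℝ, 0 < R ∧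
        lam = q / (p / (p - 1)) * ((n : ℝ) * piPQ p q / T) ^ p * R ^ (p - q) ∧
        ((∀ t ∈ Icc (0:ℝ) T, u t = R * sinpq ((n : ℝ) * piPQ p q * t / T)) ∨
         (∀ t ∈ Icc (0:ℝ) T, u t = -(R * sinpq ((n : ℝ) * piPQ p q * t / T))))) := by
  have hS : IsSinPQ p q sinpq := ⟨hinv, hrefl, hodd, hper⟩
  have hpi := piPQ_pos hp hq
  refine ⟨fun R hR n hn => ?_, fun lam hlam u hu hne => ?_⟩
  · have hn0 : (0:ℝ) < n := by exact_mod_cast hn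
    have hflow := hS.isFlow_scaled hp hq T hR (ω := n * piPQ p q / T) (by positivity)
    simp only [div_mul_eq_mul_div _ T] at hflow
    have hend : R * sinpq (n * piPQ p q * T / T) = 0 := by
      rw [mul_div_cancel_right₀ _ hT.ne', hS.map_nat_mul_pi hp hq, mul_zero]
    have hstart : R * sinpq (n * piPQ p q * 0 / T) = 0 := by
      rw [mul_zero, zero_div, hS.map_zero, mul_zero]
    refine ⟨isSolE_iff.2 ⟨_, hflow, hstart, hend⟩,
      isSolE_iff.2 ⟨_, hflow.neg, by rw [hstart, neg_zero], by rw [hend, neg_zero]⟩,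
      fun hzero => ?_⟩
    have h1 : (1:ℝ) ≤ n := by exact_mod_cast hn
    have := hzero (T / (2 * n)) ⟨by positivity, div_le_self hT.le (by linarith)⟩
    rw [show n * piPQ p q * (T / (2 * n)) / T = piPQ p q / 2 by field_simp,
      hS.map_pi_div_two, mul_one] at this
    exact hR.ne' this
  · obtain ⟨c, hflow, hu₀, huT⟩ := isSolE_iff.1 hu
    rcases (hflow.velocity_ne_zero hp hq hlam hu₀ hne).lt_or_gt with hc | hc
    · obtain ⟨n, hn, R, hR, hl, hsol⟩ := hflow.neg.exists_eigenvalue hS hp hq hT hlam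
        (by rw [hu₀, neg_zero]) (by rw [huT, neg_zero]) (neg_pos.2 hc)
      exact ⟨n, hn, R, hR, hl, Or.inr fun t ht => by rw [← hsol t ht, neg_neg]⟩
    · obtain ⟨n, hn, R, hR, hl, hsol⟩ :=
        hflow.exists_eigenvalue hS hp hq hT hlam hu₀ huT hc
      exact ⟨n, hn, R, hR, hl, Or.inl hsol⟩
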